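/- For every scalar α₊ ∈ K, the assignment ∂₊(x₋) = ∂₊(z₋) = 0, ∂₊(x₊) = α₊·c(z)·z₋, ∂₊(z₊) = α₊·x₋ on generators extends to a (right) skew σ₊-derivation ∂₊ of the generalized Weyl algebra A(p;q), i.e. a K-linear map ∂₊: A(p;q) → A(p;q) satisfying ∂₊(ab) = ∂₊(a)σ₊(b) + a∂₊(b) for all a, b ∈ A(p;q). -/

import Mathlib

noncomputable section

open Polynomial
open scoped Classical

namespace GWAPaper

variable (K : Type) [Field K]

/-- Defining relations of the generalized Weyl algebra `A(p;q)`; the generators are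
indexed by `Fin 4` with `0 ↦ x₊`, `1 ↦ x₋`, `2 ↦ z₊`, `3 ↦ z₋`. -/
inductive GWARel (q : K) (p : K[X]) :
    FreeAlgebra K (Fin 4) → FreeAlgebra K (Fin 4) → Prop
  | zz : GWARel q p (FreeAlgebra.ι K (2 : Fin 4) * FreeAlgebra.ι K (3 : Fin 4))
      (FreeAlgebra.ι K (3 : Fin 4) * FreeAlgebra.ι K (2 : Fin 4))
  | xpzp : GWARel q p (FreeAlgebra.ι K (0 : Fin 4) * FreeAlgebra.ι K (2 : Fin 4))
      (q⁻¹ • (FreeAlgebra.ι K (2 : Fin 4) * FreeAlgebra.ι K (0 : Fin 4)))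
  | xpzm : GWARel q p (FreeAlgebra.ι K (0 : Fin 4) * FreeAlgebra.ι K (3 : Fin 4))
      (q⁻¹ • (FreeAlgebra.ι K (3 : Fin 4) * FreeAlgebra.ι K (0 : Fin 4)))
  | xmzp : GWARel q p (FreeAlgebra.ι K (1 : Fin 4) * FreeAlgebra.ι K (2 : Fin 4))
      (q • (FreeAlgebra.ι K (2 : Fin 4) * FreeAlgebra.ι K (1 : Fin 4)))
  | xmzm : GWARel q p (FreeAlgebra.ι K (1 : Fin 4) * FreeAlgebra.ι K (3 : Fin 4))
      (q • (FreeAlgebra.ι K (3 : Fin 4) * FreeAlgebra.ι K (1 : Fin 4)))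
  | xpxm : GWARel q p (FreeAlgebra.ι K (0 : Fin 4) * FreeAlgebra.ι K (1 : Fin 4))
      (Polynomial.aeval (FreeAlgebra.ι K (2 : Fin 4) * FreeAlgebra.ι K (3 : Fin 4)) p)
  | xmxp : GWARel q p (FreeAlgebra.ι K (1 : Fin 4) * FreeAlgebra.ι K (0 : Fin 4))
      (Polynomial.aeval ((q ^ 2 : K) • (FreeAlgebra.ι K (3 : Fin 4) * FreeAlgebra.ι K (2 : Fin 4))) p)

/-- The generalized Weyl algebra `A(p;q)`. -/
abbrev GWA (q : K) (p : K[X]) : Type := RingQuot (GWARel K q p)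

/-- The images of the four generators in `A(p;q)`. -/
def gwaGen (q : K) (p : K[X]) (i : Fin 4) : GWA K q p :=
  RingQuot.mkAlgHom K (GWARel K q p) (FreeAlgebra.ι K i)

/-- The generator `x₊`. -/
def xp (q : K) (p : K[X]) : GWA K q p := gwaGen K q p 0
/-- The generator `x₋`. -/
def xm (q : K) (p : K[X]) : GWA K q p := gwaGen K q p 1
/-- The generator `z₊`. -/
def zp (q : K) (p : K[X]) : GWA K q p := gwaGen K q p 2
/-- The generator `z₋`. -/
def zm (q : K) (p : K[X]) : GWA K q p := gwaGen K q p 3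

/-- ℤ-degrees of the generators: `deg x₊ = deg z₊ = 1`, `deg x₋ = deg z₋ = -1`. -/
def gwaWt : Fin 4 → ℤ := ![1, -1, 1, -1]

/-- The total degree of a word in the generators. -/
def wordDeg (w : List (Fin 4)) : ℤ := (w.map gwaWt).sum

/-- The product in `A(p;q)` of the letters of a word. -/
def wordVal (q : K) (p : K[X]) (w : List (Fin 4)) : GWA K q p :=
  (w.map (gwaGen K q p)).prod

/-- The degree-`n` homogeneous component of the ℤ-graded algebra `A(p;q)`:
the `K`-linear span of the values of all words of total degree `n`. -/
def component (q : K) (p : K[X]) (n : ℤ) : Submodule K (GWA K q p) :=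
  Submodule.span K {a | ∃ w : List (Fin 4), wordDeg w = n ∧ wordVal K q p w = a}

/-- The `q²`-derivative `p_{q²}` of a polynomial `p`, equal to
`(p(q²z) - p(z))/((q²-1)z)` if `q² ≠ 1` and to `p'` if `q² = 1`. -/
def qDeriv (q : K) (p : K[X]) : K[X] :=
  if q ^ 2 = 1 then derivative p
  else (p.comp (C (q ^ 2) * X) - p) / (C (q ^ 2 - 1) * X)

/-- The polynomial `c(z) = q·p_{q²}(z)`. -/
def cPoly (q : K) (p : K[X]) : K[X] := C q * qDeriv K q p

/-- `p` is `q²`-separable: `p(z)` is coprime with `z·p_{q²}(z)`. -/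
def QSeparable (q : K) (p : K[X]) : Prop := IsCoprime p (X * qDeriv K q p)


section qDeriv

variable {K}

theorem qDeriv_of_sq_eq_one {q : K} (h : q ^ 2 = 1) (p : K[X]) :
    qDeriv K q p = derivative p := if_pos h

/-- The division in the definition of `qDeriv` is exact. -/
theorem qDeriv_spec (q : K) (p : K[X]) :
    C (q ^ 2 - 1) * X * qDeriv K q p = p.comp (C (q ^ 2) * X) - p := by
  by_cases h : q ^ 2 = 1
  · simp [h]
  · have hdvd : C (q ^ 2 - 1) * X ∣ p.comp (C (q ^ 2) * X) - p := by
      rw [IsUnit.mul_left_dvd (isUnit_C.2 (sub_ne_zero.2 h).isUnit), X_dvd_iff,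
        coeff_zero_eq_eval_zero]
      simp [eval_comp]
    rw [qDeriv, if_neg h]
    exact EuclideanDomain.mul_div_cancel'
      (mul_ne_zero (C_ne_zero.2 (sub_ne_zero.2 h)) X_ne_zero) hdvd

theorem qDeriv_eq_of_mul_eq {q : K} (h : q ^ 2 ≠ 1) {p r : K[X]}
    (hr : C (q ^ 2 - 1) * X * r = p.comp (C (q ^ 2) * X) - p) : qDeriv K q p = r := by
  have h0 : (C (q ^ 2 - 1) * X : K[X]) ≠ 0 :=
      mul_ne_zero (C_ne_zero.2 (sub_ne_zero.2 h)) X_ne_zero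
  exact mul_left_cancel₀ h0 ((qDeriv_spec q p).trans hr.symm)

theorem qDeriv_C (q a : K) : qDeriv K q (C a) = 0 := by
  by_cases h : q ^ 2 = 1
  · simp [qDeriv_of_sq_eq_one h]
  · exact qDeriv_eq_of_mul_eq h (by simp)

theorem qDeriv_add (q : K) (p r : K[X]) :
    qDeriv K q (p + r) = qDeriv K q p + qDeriv K q r := by
  by_cases h : q ^ 2 = 1
  · simp [qDeriv_of_sq_eq_one h]
  · refine qDeriv_eq_of_mul_eq h ?_
    rw [mul_add, qDeriv_spec, qDeriv_spec, add_comp]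
    ring

theorem qDeriv_mul_X (q : K) (p : K[X]) :
    qDeriv K q (p * X) = p + C (q ^ 2) * X * qDeriv K q p := by
  by_cases h : q ^ 2 = 1
  · simp only [qDeriv_of_sq_eq_one h, h, derivative_mul, derivative_X, C_1]
    ring
  · refine qDeriv_eq_of_mul_eq h ?_
    have := qDeriv_spec q p
    rw [mul_comp, X_comp]
    simp only [C_sub, C_1] at this ⊢
    linear_combination C (q ^ 2) * X * this

end qDeriv

section Triangular

variable {K} {R : Type*} [Ring R] [Algebra K R]

theorem aeval_semiconj {x y z : R} (h : x * z = y * x) (r : K[X]) :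
    x * aeval z r = aeval y r * x := by
  induction r using Polynomial.induction_on' with
  | add p r hp hr => simp only [map_add, mul_add, add_mul, hp, hr]
  | monomial n a =>
    have hn : x * z ^ n = y ^ n * x := SemiconjBy.pow_right (a := x) (x := z) (y := y) h n
    simp only [aeval_monomial, mul_assoc, ← hn]
    rw [← mul_assoc, ← mul_assoc, Algebra.commutes]

theorem triangular_mul (a d b a' d' b' : R) :
    !![a, d; 0, b] * !![a', d'; 0, b'] = !![a * a', a * d' + d * b'; 0, b * b'] := by
  simp

theorem triangular_congr {a d b a' d' b' : R} (ha : a = a') (hd : d = d') (hb : b = b') :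
    !![a, d; 0, b] = !![a', d'; 0, b'] := by
  rw [ha, hd, hb]

theorem triangular_smul (k : K) (a d b : R) :
    k • !![a, d; 0, b] = !![k • a, k • d; 0, k • b] := by
  simp [Matrix.smul_of]

theorem aeval_qDeriv_mul (q : K) (p : K[X]) (z : R) :
    q ^ 2 • (aeval z (qDeriv K q p) * z) + aeval z p =
      aeval (q ^ 2 • z) p + aeval z (qDeriv K q p) * z := by
  have h : C (q ^ 2) * (qDeriv K q p * X) + p =
      p.comp (C (q ^ 2) * X) + qDeriv K q p * X := by
    have := qDeriv_spec q p
    rw [C_sub, C_1] at this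
    linear_combination this
  simpa [aeval_comp, Algebra.smul_def] using congrArg (aeval z) h

/-- Evaluating `p` at an upper triangular matrix whose off-diagonal entry `q²`-commutes with
the diagonal one produces the `q²`-derivative of `p` off the diagonal. -/
theorem aeval_triangular {q : K} {z w : R} (h : w * z = q ^ 2 • (z * w)) (p : K[X]) :
    aeval !![z, w; 0, z] p = !![aeval z p, aeval z (qDeriv K q p) * w; 0, aeval z p] := by
  induction p using Polynomial.induction_on with
  | C a =>
    ext i j
    fin_cases i <;> fin_cases j <;> simp [qDeriv_C, Matrix.algebraMap_matrix_apply]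
  | add p r hp hr =>
    rw [map_add, hp, hr]
    ext i j
    fin_cases i <;> fin_cases j <;> simp [qDeriv_add, add_mul]
  | monomial n a ih =>
    rw [pow_succ, ← mul_assoc, map_mul, ih, aeval_X, triangular_mul, qDeriv_mul_X]
    refine triangular_congr ?_ ?_ ?_
    · simp
    · have hc : z * aeval z (qDeriv K q (C a * X ^ n)) =
          aeval z (qDeriv K q (C a * X ^ n)) * z := aeval_semiconj rfl _
      rw [mul_assoc _ w z, h]
      simp only [map_add, map_mul, aeval_C, aeval_X, add_mul, mul_assoc, mul_smul_comm,
        ← Algebra.smul_def, smul_mul_assoc]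
      rw [← mul_assoc z, hc, mul_assoc]
    · simp

end Triangular

section Relations

variable {K} (q : K) (p : K[X])

theorem zp_mul_zm : zp K q p * zm K q p = zm K q p * zp K q p := by
  simpa [zp, zm, gwaGen] using RingQuot.mkAlgHom_rel K (GWARel.zz (q := q) (p := p))

theorem xp_mul_zp : xp K q p * zp K q p = q⁻¹ • (zp K q p * xp K q p) := by
  simpa [zp, xp, gwaGen] using RingQuot.mkAlgHom_rel K (GWARel.xpzp (q := q) (p := p))

theorem xp_mul_zm : xp K q p * zm K q p = q⁻¹ • (zm K q p * xp K q p) := by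
  simpa [zm, xp, gwaGen] using RingQuot.mkAlgHom_rel K (GWARel.xpzm (q := q) (p := p))

theorem xm_mul_zp : xm K q p * zp K q p = q • (zp K q p * xm K q p) := by
  simpa [zp, xm, gwaGen] using RingQuot.mkAlgHom_rel K (GWARel.xmzp (q := q) (p := p))

theorem xm_mul_zm : xm K q p * zm K q p = q • (zm K q p * xm K q p) := by
  simpa [zm, xm, gwaGen] using RingQuot.mkAlgHom_rel K (GWARel.xmzm (q := q) (p := p))

theorem xp_mul_xm : xp K q p * xm K q p = aeval (zp K q p * zm K q p) p := by
  simpa [zm, xm, xp, zp, gwaGen, ← aeval_algHom_apply] using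
    RingQuot.mkAlgHom_rel K (GWARel.xpxm (q := q) (p := p))

theorem xm_mul_xp :
    xm K q p * xp K q p = aeval (q ^ 2 • (zm K q p * zp K q p)) p := by
  simpa [zm, xm, xp, zp, gwaGen, ← aeval_algHom_apply] using
    RingQuot.mkAlgHom_rel K (GWARel.xmxp (q := q) (p := p))

theorem gwaGen_mem_component (i : Fin 4) : gwaGen K q p i ∈ component K q p (gwaWt i) :=
  Submodule.subset_span ⟨[i], by simp [wordDeg], by simp [wordVal]⟩

theorem xm_mul_z : xm K q p * (zp K q p * zm K q p) =
    q ^ 2 • (zm K q p * zp K q p) * xm K q p := by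
  rw [← mul_assoc, xm_mul_zp, smul_mul_assoc, mul_assoc, xm_mul_zm, ← zp_mul_zm]
  simp only [mul_smul_comm, smul_mul_assoc, smul_smul, mul_assoc, sq]

theorem zm_mul_z : zm K q p * (zp K q p * zm K q p) =
    zp K q p * zm K q p * zm K q p := by
  rw [← mul_assoc, ← zp_mul_zm]

theorem zp_mul_z : zp K q p * (zp K q p * zm K q p) =
    zp K q p * zm K q p * zp K q p := by
  rw [mul_assoc _ (zm K q p), ← zp_mul_zm]

theorem zm_mul_xm_mul_z : zm K q p * xm K q p * (zp K q p * zm K q p) =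
    q ^ 2 • (zp K q p * zm K q p * (zm K q p * xm K q p)) := by
  rw [mul_assoc, xm_mul_z, smul_mul_assoc, mul_smul_comm, ← zp_mul_zm, ← mul_assoc, zm_mul_z,
    mul_assoc _ (zm K q p) (xm K q p)]

theorem aeval_cPoly (z : GWA K q p) : aeval z (cPoly K q p) = q • aeval z (qDeriv K q p) := by
  simp [cPoly, Algebra.smul_def]

/-- `c(z)z₋z₊` measures the difference between `x₋x₊` and `x₊x₋`. -/
theorem aeval_cPoly_mul_z (hq : q ≠ 0) :
    q • (aeval (zp K q p * zm K q p) (cPoly K q p) * (zp K q p * zm K q p)) + xp K q p * xm K q p =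
      xm K q p * xp K q p +
        q⁻¹ • (aeval (zp K q p * zm K q p) (cPoly K q p) * (zp K q p * zm K q p)) := by
  rw [xm_mul_xp, xp_mul_xm, ← zp_mul_zm, aeval_cPoly, smul_mul_assoc, smul_smul, smul_smul,
    inv_mul_cancel₀ hq, one_smul, ← sq, aeval_qDeriv_mul]

/-- The images `[a, ∂₊ a; 0, σ₊ a]` of the generators `a` under the matrix representation
which encodes `∂₊`. -/
def dplusMatrix (αp : K) : Fin 4 → Matrix (Fin 2) (Fin 2) (GWA K q p) :=
  ![!![xp K q p, αp • (aeval (zp K q p * zm K q p) (cPoly K q p) * zm K q p); 0, q • xp K q p],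
    !![xm K q p, 0; 0, q⁻¹ • xm K q p],
    !![zp K q p, αp • xm K q p; 0, q • zp K q p],
    !![zm K q p, 0; 0, q⁻¹ • zm K q p]]

theorem dplusMatrix_zp_mul_zm (hq : q ≠ 0) (αp : K) :
    dplusMatrix q p αp 2 * dplusMatrix q p αp 3 =
      !![zp K q p * zm K q p, αp • (zm K q p * xm K q p); 0, zp K q p * zm K q p] := by
  simp [dplusMatrix, xm_mul_zm, smul_smul, hq]

theorem dplusMatrix_zm_mul_zp (hq : q ≠ 0) (αp : K) :
    dplusMatrix q p αp 3 * dplusMatrix q p αp 2 =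
      !![zp K q p * zm K q p, αp • (zm K q p * xm K q p); 0, zp K q p * zm K q p] := by
  simp [dplusMatrix, smul_smul, hq, zp_mul_zm]

theorem lift_dplusMatrix_rel (hq : q ≠ 0) (αp : K) {x y : FreeAlgebra K (Fin 4)}
    (h : GWARel K q p x y) :
    FreeAlgebra.lift K (dplusMatrix q p αp) x = FreeAlgebra.lift K (dplusMatrix q p αp) y := by
  set z := zp K q p * zm K q p with hz
  have hw : αp • (zm K q p * xm K q p) * z = q ^ 2 • (z * αp • (zm K q p * xm K q p)) := by
    rw [smul_mul_assoc, zm_mul_xm_mul_z, mul_smul_comm, smul_comm]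
  have hzm : ∀ r : K[X], zm K q p * aeval z r = aeval z r * zm K q p :=
    aeval_semiconj (zm_mul_z q p)
  have hzp : ∀ r : K[X], zp K q p * aeval z r = aeval z r * zp K q p :=
    aeval_semiconj (zp_mul_z q p)
  cases h <;> simp only [map_mul, map_smul, FreeAlgebra.lift_ι_apply, ← aeval_algHom_apply]
  case zz => rw [dplusMatrix_zp_mul_zm q p hq, dplusMatrix_zm_mul_zp q p hq]
  case xpzp =>
    simp only [dplusMatrix, Matrix.cons_val, triangular_mul, triangular_smul]
    refine triangular_congr (xp_mul_zp q p) ?_ (by simp [xp_mul_zp, smul_smul, hq])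
    have h := congrArg (αp • ·) (aeval_cPoly_mul_z q p hq)
    rw [← hz] at h ⊢
    simp only [mul_smul_comm, smul_mul_assoc, mul_assoc, ← zp_mul_zm, ← hz, smul_add] at h ⊢
    rw [← mul_assoc (zp K q p), hzp, mul_assoc, ← hz, smul_comm q⁻¹ αp,
      smul_smul q⁻¹ q, inv_mul_cancel₀ hq, one_smul, smul_comm q αp, add_comm, h, add_comm]
  case xpzm =>
    simp only [dplusMatrix, Matrix.cons_val, triangular_mul, triangular_smul]
    refine triangular_congr (xp_mul_zm q p) ?_ (by simp [xp_mul_zm, smul_smul, hq])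
    simp only [mul_smul_comm, smul_mul_assoc, mul_zero, zero_mul, zero_add, smul_zero,
      add_zero,
      ← mul_assoc]
    rw [← hz, hzm]
  case xmzp =>
    simp only [dplusMatrix, Matrix.cons_val, triangular_mul, triangular_smul]
    refine triangular_congr (xm_mul_zp q p) ?_ (by simp [xm_mul_zp, smul_smul, hq])
    simp [smul_smul, hq]
  case xmzm =>
    simp only [dplusMatrix, Matrix.cons_val, triangular_mul, triangular_smul]
    exact triangular_congr (xm_mul_zm q p) (by simp)
      (by simp [xm_mul_zm, smul_smul, mul_comm, mul_left_comm])
  case xpxm =>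
    rw [dplusMatrix_zp_mul_zm q p hq, aeval_triangular hw]
    simp only [dplusMatrix, Matrix.cons_val, triangular_mul]
    refine triangular_congr (xp_mul_xm q p) ?_ (by simp [hq, smul_smul, xp_mul_xm, hz])
    rw [← hz, aeval_cPoly]
    simp [smul_smul, hq, mul_assoc, mul_comm αp]
  case xmxp =>
    have hw' : q ^ 2 • αp • (zm K q p * xm K q p) * (q ^ 2 • z) =
        q ^ 2 • (q ^ 2 • z * q ^ 2 • αp • (zm K q p * xm K q p)) := by
      rw [smul_mul_smul_comm, hw, smul_mul_smul_comm, smul_comm]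
    rw [dplusMatrix_zm_mul_zp q p hq, triangular_smul, aeval_triangular hw']
    simp only [dplusMatrix, Matrix.cons_val, triangular_mul]
    have hx := xm_mul_xp q p
    rw [← zp_mul_zm, ← hz] at hx
    refine triangular_congr hx ?_ (by simp [smul_smul, hq, hx])
    have hxz := xm_mul_z q p
    rw [← zp_mul_zm, ← hz] at hxz
    rw [← hz, mul_smul_comm, ← mul_assoc, aeval_semiconj hxz, aeval_cPoly, mul_assoc, xm_mul_zm]
    simp [smul_smul, sq, mul_comm, mul_left_comm]

end Relations

/-- For every `α₊ ∈ K` the given assignment on generators extends to a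
right skew `σ₊`-derivation `∂₊` of `A(p;q)`. -/
theorem skew_derivation_dplus_exists [CharZero K]
    (q : K) (hq : q ≠ 0) (p : K[X])
    (αp : K)
    (σm : GWA K q p ≃ₐ[K] GWA K q p)
    (hσm : ∀ (n : ℤ) (a : GWA K q p), a ∈ component K q p n → σm a = q ^ n • a)
    :
    ∃ Dp : GWA K q p →ₗ[K] GWA K q p,
      Dp (xm K q p) = 0 ∧
      Dp (zm K q p) = 0 ∧
      Dp (xp K q p) = αp • (aeval (zp K q p * zm K q p) (cPoly K q p) * zm K q p) ∧
      Dp (zp K q p) = αp • xm K q p ∧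
      ∀ a b : GWA K q p, Dp (a * b) = Dp a * σm b + a * Dp b := by
  let φ : GWA K q p →ₐ[K] Matrix (Fin 2) (Fin 2) (GWA K q p) :=
    RingQuot.liftAlgHom K ⟨FreeAlgebra.lift K (dplusMatrix q p αp),
      fun _ _ h => lift_dplusMatrix_rel q p hq αp h⟩
  have hgen (i : Fin 4) : φ (gwaGen K q p i) = dplusMatrix q p αp i := by
    simp [φ, gwaGen]
  have hσ (i : Fin 4) : σm (gwaGen K q p i) = q ^ gwaWt i • gwaGen K q p i :=
    hσm _ _ (gwaGen_mem_component q p i)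
  have hφ (a : GWA K q p) : φ a 0 0 = a ∧ φ a 1 0 = 0 ∧ φ a 1 1 = σm a := by
    obtain ⟨a, rfl⟩ := RingQuot.mkAlgHom_surjective K (GWARel K q p) a
    induction a using FreeAlgebra.induction with
    | grade0 r => simp [Matrix.algebraMap_matrix_apply]
    | grade1 i =>
      rw [← gwaGen, hgen, hσ]
      fin_cases i <;> simp [dplusMatrix, gwaWt, xp, xm, zp, zm]
    | mul a b ha hb =>
      simp only [map_mul, Matrix.mul_apply, Fin.sum_univ_two, ha, hb]
      simp
    | add a b ha hb =>
      simp only [map_add, Matrix.add_apply, ha, hb]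
      simp
  refine ⟨Matrix.entryLinearMap K (GWA K q p) 0 1 ∘ₗ φ.toLinearMap, ?_, ?_, ?_, ?_, fun a b => ?_⟩
  · simp [xm, hgen, dplusMatrix]
  · simp [zm, hgen, dplusMatrix]
  · simp [xp, hgen, dplusMatrix]
  · simp [zp, hgen, dplusMatrix]
  · change φ (a * b) 0 1 = φ a 0 1 * σm b + a * φ b 0 1
    rw [map_mul, Matrix.mul_apply, Fin.sum_univ_two, (hφ a).1, (hφ b).2.2, add_comm]

end GWAPaper
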